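/- arXiv:2202.06677 — 2 statements merged into one kernel-verified Lean document; each statement's English description precedes it below -/
import Mathlib

section
/- Let Σ = (X, X₀, X_S, U, →, Y, H) be a finite metric system, let δ ≥ 0, and let Obs(Σ) = (Q, Q₀, U, →_obs) be its δ-approximate observer, restricted to the states reachable from Q₀. Then Σ is δ-approximate current-state opaque if and only if for every reachable observer state q = (x, z), the set cur(q) = {x_C : (x_I, x_C) ∈ z} is not contained in X_S. -/
/-!
Statement 1: For a finite metric system Σ, δ-approximate current-state opacity
holds iff every reachable state q = (x, z) of the δ-approximate observer
satisfies cur(q) ⊄ X_S.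
-/

variable {X U Y : Type*}

/-- A finite path of length `n` of the system with initial states `X0` and
transition relation `tr`: `p 0 ∈ X0` and consecutive states are related by some input. -/
def IsPath (X0 : Set X) (tr : X → U → X → Prop) (n : ℕ) (p : ℕ → X) : Prop :=
  p 0 ∈ X0 ∧ ∀ i < n, ∃ u, tr (p i) u (p (i + 1))

/-- δ-approximate current-state opacity. -/
def ApproxCurrentStateOpaque [MetricSpace Y] (X0 XS : Set X) (tr : X → U → X → Prop)
    (H : X → Y) (δ : ℝ) : Prop :=
  ∀ n : ℕ, ∀ p : ℕ → X, IsPath X0 tr n p → p n ∈ XS →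
    ∃ p' : ℕ → X, IsPath X0 tr n p' ∧ p' n ∉ XS ∧
      ∀ i ≤ n, dist (H (p i)) (H (p' i)) ≤ δ

/-- Initial states of the δ-approximate observer. -/
def ObsInit [MetricSpace Y] (X0 : Set X) (H : X → Y) (δ : ℝ) :
    Set (X × Set (X × X)) :=
  {q | q.1 ∈ X0 ∧ q.2 ⊆ X0 ×ˢ X0 ∧
    ∀ xI xC, xI ∈ X0 → xC ∈ X0 →
      ((xI, xC) ∈ q.2 ↔ xI = xC ∧ dist (H q.1) (H xC) ≤ δ)}

/-- Transition relation of the δ-approximate observer. -/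
def ObsTr [MetricSpace Y] (tr : X → U → X → Prop) (H : X → Y) (δ : ℝ)
    (q : X × Set (X × X)) (u : U) (q' : X × Set (X × X)) : Prop :=
  tr q.1 u q'.1 ∧
    q'.2 = {r : X × X | ∃ u' xC, (r.1, xC) ∈ q.2 ∧ tr xC u' r.2 ∧
      dist (H q'.1) (H r.2) ≤ δ}

/-- The set of observer states reachable from the initial observer states. -/
def ObsReach [MetricSpace Y] (X0 : Set X) (tr : X → U → X → Prop) (H : X → Y)
    (δ : ℝ) : Set (X × Set (X × X)) :=
  {q | ∃ q0 ∈ ObsInit X0 H δ,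
    Relation.ReflTransGen (fun a b => ∃ u, ObsTr tr H δ a u b) q0 q}

section ObserverPaths

variable [MetricSpace Y] {X0 : Set X} {tr : X → U → X → Prop} {H : X → Y} {δ : ℝ}
  {n : ℕ} {p : ℕ → X}

theorem IsPath.of_succ (hp : IsPath X0 tr (n + 1) p) : IsPath X0 tr n p :=
  ⟨hp.1, fun i hi => hp.2 i (Nat.lt_succ_of_lt hi)⟩

theorem IsPath.congr {p' : ℕ → X} (hp : IsPath X0 tr n p) (h : ∀ i ≤ n, p' i = p i) :
    IsPath X0 tr n p' := by
  refine ⟨by rw [h 0 n.zero_le]; exact hp.1, fun i hi => ?_⟩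
  rw [h i hi.le, h (i + 1) hi]
  exact hp.2 i hi

theorem IsPath.extend {x : X} (hp : IsPath X0 tr n p) (hx : ∃ u, tr (p n) u x) :
    IsPath X0 tr (n + 1) (Function.update p (n + 1) x) := by
  have h : ∀ i ≤ n, Function.update p (n + 1) x i = p i := fun i hi =>
    Function.update_of_ne (by omega) _ _
  refine ⟨(hp.congr h).1, fun i hi => ?_⟩
  rcases Nat.lt_succ_iff_lt_or_eq.mp hi with hi | rfl
  · exact (hp.congr h).2 i hi
  · rw [h i le_rfl, Function.update_self]
    exact hx

/-- The initial-current pairs joined by a path of length `n` whose outputs stay `δ`-close to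
those of `p`. -/
def closePathPairs (X0 : Set X) (tr : X → U → X → Prop) (H : X → Y) (δ : ℝ) (n : ℕ)
    (p : ℕ → X) : Set (X × X) :=
  {r | ∃ p' : ℕ → X, IsPath X0 tr n p' ∧ p' 0 = r.1 ∧ p' n = r.2 ∧
    ∀ i ≤ n, dist (H (p i)) (H (p' i)) ≤ δ}

theorem closePathPairs_congr {p₁ p₂ : ℕ → X} (h : ∀ i ≤ n, p₁ i = p₂ i) :
    closePathPairs X0 tr H δ n p₁ = closePathPairs X0 tr H δ n p₂ := by
  ext r
  refine exists_congr fun p' => and_congr_right fun _ => and_congr_right fun _ =>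
    and_congr_right fun _ => forall₂_congr fun i hi => ?_
  rw [h i hi]

theorem closePathPairs_succ :
    closePathPairs X0 tr H δ (n + 1) p =
      {r : X × X | ∃ u xC, (r.1, xC) ∈ closePathPairs X0 tr H δ n p ∧ tr xC u r.2 ∧
        dist (H (p (n + 1))) (H r.2) ≤ δ} := by
  ext ⟨a, b⟩
  constructor
  · rintro ⟨p', hp', rfl, rfl, hd⟩
    obtain ⟨u, hu⟩ := hp'.2 n n.lt_succ_self
    exact ⟨u, p' n, ⟨p', hp'.of_succ, rfl, rfl, fun i hi => hd i (Nat.le_succ_of_le hi)⟩,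
      hu, hd _ le_rfl⟩
  · rintro ⟨u, xC, ⟨p', hp', h0, rfl, hd⟩, hu, hb⟩
    refine ⟨_, hp'.extend ⟨u, hu⟩, ?_, Function.update_self _ _ _, fun i hi => ?_⟩
    · rw [Function.update_of_ne (by omega)]
      exact h0
    · rcases Nat.le_succ_iff.mp hi with hi | rfl
      · rw [Function.update_of_ne (by omega)]
        exact hd i hi
      · rw [Function.update_self]
        exact hb

theorem mem_obsInit_iff {q : X × Set (X × X)} :
    q ∈ ObsInit X0 H δ ↔ q.1 ∈ X0 ∧
      q.2 = closePathPairs X0 tr H δ 0 (fun _ => q.1) := by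
  have mem_zero : ∀ a b, (a, b) ∈ closePathPairs X0 tr H δ 0 (fun _ => q.1) ↔
      a ∈ X0 ∧ a = b ∧ dist (H q.1) (H b) ≤ δ := by
    refine fun a b => ⟨?_, ?_⟩
    · rintro ⟨p', hp', rfl, rfl, hd⟩
      exact ⟨hp'.1, rfl, hd 0 le_rfl⟩
    · rintro ⟨ha, rfl, hd⟩
      exact ⟨fun _ => a, ⟨ha, by simp⟩, rfl, rfl, fun _ _ => hd⟩
  refine and_congr_right fun _ => ⟨?_, fun h => ?_⟩
  · rintro ⟨hsub, h⟩
    ext ⟨a, b⟩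
    rw [mem_zero]
    refine ⟨fun hab => ⟨(hsub hab).1, (h a b (hsub hab).1 (hsub hab).2).1 hab⟩, ?_⟩
    rintro ⟨ha, rfl, hd⟩
    exact (h a a ha ha).2 ⟨rfl, hd⟩
  · rw [h]
    refine ⟨?_, fun a b ha _ => by rw [mem_zero]; exact and_iff_right ha⟩
    rintro ⟨a, b⟩ hab
    obtain ⟨ha, rfl, -⟩ := (mem_zero a b).1 hab
    exact ⟨ha, ha⟩

theorem mem_obsReach_of_isPath (hp : IsPath X0 tr n p) :
    (p n, closePathPairs X0 tr H δ n p) ∈ ObsReach X0 tr H δ := by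
  induction n with
  | zero =>
    refine ⟨_, (mem_obsInit_iff (tr := tr)).2 ⟨hp.1, ?_⟩, .refl⟩
    exact closePathPairs_congr fun i hi => by rw [Nat.le_zero.mp hi]
  | succ n ih =>
    obtain ⟨q0, hq0, hreach⟩ := ih hp.of_succ
    obtain ⟨u, hu⟩ := hp.2 n n.lt_succ_self
    exact ⟨q0, hq0, hreach.tail ⟨u, hu, closePathPairs_succ⟩⟩

theorem exists_isPath_of_mem_obsReach {q : X × Set (X × X)} (hq : q ∈ ObsReach X0 tr H δ) :
    ∃ n p, IsPath X0 tr n p ∧ p n = q.1 ∧ q.2 = closePathPairs X0 tr H δ n p := by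
  obtain ⟨q0, hq0, hreach⟩ := hq
  induction hreach with
  | refl =>
    obtain ⟨h0, hz⟩ := (mem_obsInit_iff (tr := tr)).1 hq0
    exact ⟨0, fun _ => q0.1, ⟨h0, by simp⟩, rfl, hz⟩
  | @tail b c _ hstep ih =>
    obtain ⟨n, p, hp, hpn, hz⟩ := ih
    obtain ⟨u, hu, hc⟩ := hstep
    refine ⟨n + 1, _, hp.extend ⟨u, hpn ▸ hu⟩, Function.update_self _ _ _, ?_⟩
    rw [closePathPairs_succ, Function.update_self, hc, hz,
      closePathPairs_congr (p₁ := Function.update p (n + 1) c.1) (p₂ := p)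
        fun i hi => Function.update_of_ne (by omega) _ _]

end ObserverPaths

/-- **Verification of approximate current-state opacity via the observer.**
A finite metric system is δ-approximate current-state opaque iff for every
reachable observer state `q = (x, z)`, `cur(q) = {x_C | ∃ x_I, (x_I, x_C) ∈ z}`
is not contained in the secret set `XS`. -/
theorem approx_current_state_opacity_iff_observer
    [Finite X] [Finite U] [MetricSpace Y]
    (X0 XS : Set X) (tr : X → U → X → Prop) (H : X → Y) (δ : ℝ) (hδ : 0 ≤ δ) :
    ApproxCurrentStateOpaque X0 XS tr H δ ↔
      ∀ q ∈ ObsReach X0 tr H δ, ¬ ({xC | ∃ xI, (xI, xC) ∈ q.2} ⊆ XS) := by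
  constructor
  · intro hop q hq hsub
    obtain ⟨n, p, hp, hpn, hz⟩ := exists_isPath_of_mem_obsReach hq
    have hmem : ∀ p', IsPath X0 tr n p' → (∀ i ≤ n, dist (H (p i)) (H (p' i)) ≤ δ) →
        p' n ∈ XS := fun p' hp' hd =>
      hsub ⟨p' 0, by rw [hz]; exact ⟨p', hp', rfl, rfl, hd⟩⟩
    obtain ⟨p', hp', hns, hd⟩ := hop n p hp (hmem p hp fun i _ => by simpa using hδ)
    exact hns (hmem p' hp' hd)
  · intro h n p hp _
    obtain ⟨_, ⟨xI, p', hp', -, rfl, hd⟩, hns⟩ :=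
      Set.not_subset.mp (h _ (mem_obsReach_of_isPath hp))
    exact ⟨p', hp', hns, hd⟩
end

section
/- Let Σ = (X, X₀, X_S, U, →, Y, H) be a metric system, let δ ≥ 0, and let Obs(Σ) = (Q, Q₀, U, →_obs) be its δ-approximate observer. For every run q₀ →_obs^{u₁} q₁ →_obs^{u₂} ⋯ →_obs^{uₙ} qₙ of Obs(Σ) with q₀ ∈ Q₀, writing qᵢ = (xᵢ, zᵢ), the following hold: (i) x₀x₁⋯xₙ is a finite path of Σ; and (ii) for all states x_I, x_C ∈ X, (x_I, x_C) ∈ zₙ if and only if there exists a finite path x₀′x₁′⋯xₙ′ of Σ with x₀′ = x_I, xₙ′ = x_C, and d(H(xᵢ), H(xᵢ′)) ≤ δ for all 0 ≤ i ≤ n. -/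
/-!
Statement 2: correctness of the δ-approximate observer. Along any run of the
observer from an initial observer state: (i) the first components form a finite
path of Σ, and (ii) the second component of the last observer state contains
exactly the initial/current state pairs of δ-close paths of Σ.
-/

variable {X U Y : Type*}

/-- Replacing the state at time `n + 1` by a successor of the state at time `n`
extends a path of length `n` to one of length `n + 1`. -/
theorem IsPath.update_succ {X0 : Set X} {tr : X → U → X → Prop} {n : ℕ} {p : ℕ → X}
    (hp : IsPath X0 tr n p) {u : U} {x : X} (hx : tr (p n) u x) :
    IsPath X0 tr (n + 1) (Function.update p (n + 1) x) := by
  refine ⟨by simpa [Function.update] using hp.1, fun i hi => ?_⟩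
  rw [Function.update_of_ne (by omega : i ≠ n + 1)]
  rcases Nat.lt_succ_iff_lt_or_eq.1 hi with h | rfl
  · rw [Function.update_of_ne (by omega : i + 1 ≠ n + 1)]
    exact hp.2 i h
  · exact ⟨u, by simpa using hx⟩

/-- The second component of an initial observer state is the set of pairs `(x, x)`
with `x` an initial state whose output is δ-close to that of the first component. -/
theorem mem_snd_of_mem_obsInit [MetricSpace Y] {X0 : Set X} {H : X → Y} {δ : ℝ}
    {q : X × Set (X × X)} (hq : q ∈ ObsInit X0 H δ) {xI xC : X} :
    (xI, xC) ∈ q.2 ↔ xI ∈ X0 ∧ xI = xC ∧ dist (H q.1) (H xC) ≤ δ := by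
  obtain ⟨-, hsub, hiff⟩ := hq
  constructor
  · intro h
    have hX := hsub h
    exact ⟨hX.1, (hiff xI xC hX.1 hX.2).1 h⟩
  · rintro ⟨hI, rfl, hd⟩
    exact (hiff xI xI hI hI).2 ⟨rfl, hd⟩

/-- The second component of the last state of an observer run consists of the pairs of
end points of the paths that stay δ-close to the run. -/
theorem mem_snd_of_obsTr_run [MetricSpace Y] {X0 : Set X} {tr : X → U → X → Prop}
    {H : X → Y} {δ : ℝ} {n : ℕ} {q : ℕ → X × Set (X × X)}
    (h0 : q 0 ∈ ObsInit X0 H δ)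
    (hstep : ∀ i < n, ∃ u, ObsTr tr H δ (q i) u (q (i + 1))) (xI xC : X) :
    (xI, xC) ∈ (q n).2 ↔
      ∃ p' : ℕ → X, IsPath X0 tr n p' ∧ p' 0 = xI ∧ p' n = xC ∧
        ∀ i ≤ n, dist (H ((q i).1)) (H (p' i)) ≤ δ := by
  induction n generalizing xC with
  | zero =>
    rw [mem_snd_of_mem_obsInit h0]
    constructor
    · rintro ⟨hI, rfl, hd⟩
      refine ⟨fun _ => xI, ⟨hI, fun i hi => absurd hi (Nat.not_lt_zero i)⟩, rfl, rfl,
        fun i hi => ?_⟩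
      obtain rfl := Nat.le_zero.1 hi
      exact hd
    · rintro ⟨p', hp, rfl, rfl, hd⟩
      exact ⟨hp.1, rfl, hd 0 le_rfl⟩
  | succ n ih =>
    replace ih := ih fun i hi => hstep i (hi.trans n.lt_succ_self)
    obtain ⟨-, -, hz⟩ := hstep n n.lt_succ_self
    rw [hz]
    constructor
    · rintro ⟨u', x, hx, htr, hd⟩
      obtain ⟨p', hp, h0', rfl, hclose⟩ := (ih x).1 hx
      refine ⟨Function.update p' (n + 1) xC, hp.update_succ htr, ?_, by simp, fun i hi => ?_⟩
      · rwa [Function.update_of_ne n.succ_ne_zero.symm]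
      · rcases Nat.le_succ_iff.1 hi with h | rfl
        · rw [Function.update_of_ne (by omega : i ≠ n + 1)]
          exact hclose i h
        · simpa using hd
    · rintro ⟨p', hp, h0', rfl, hclose⟩
      obtain ⟨u', htr⟩ := hp.2 n n.lt_succ_self
      exact ⟨u', p' n, (ih (p' n)).2 ⟨p', ⟨hp.1, fun i hi => hp.2 i (by omega)⟩, h0', rfl,
        fun i hi => hclose i (by omega)⟩, htr, hclose _ le_rfl⟩

/-- **Correctness of the δ-approximate observer.** For every run
`q 0 → q 1 → ⋯ → q n` of the observer with `q 0` initial, writing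
`q i = (x i, z i)`: (i) `x` is a finite path of Σ; (ii) `(x_I, x_C) ∈ z n`
iff there is a finite path `p'` of Σ of length `n` from `x_I` to `x_C` whose
outputs are δ-close to those of `x` at every instant. -/
theorem observer_run_correctness [MetricSpace Y]
    (X0 : Set X) (tr : X → U → X → Prop) (H : X → Y) (δ : ℝ) (hδ : 0 ≤ δ)
    (n : ℕ) (q : ℕ → X × Set (X × X))
    (h0 : q 0 ∈ ObsInit X0 H δ)
    (hstep : ∀ i < n, ∃ u, ObsTr tr H δ (q i) u (q (i + 1))) :
    IsPath X0 tr n (fun i => (q i).1) ∧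
      ∀ xI xC : X, (xI, xC) ∈ (q n).2 ↔
        ∃ p' : ℕ → X, IsPath X0 tr n p' ∧ p' 0 = xI ∧ p' n = xC ∧
          ∀ i ≤ n, dist (H ((q i).1)) (H (p' i)) ≤ δ := by
  refine ⟨⟨h0.1, fun i hi => ?_⟩, mem_snd_of_obsTr_run h0 hstep⟩
  obtain ⟨u, htr, -⟩ := hstep i hi
  exact ⟨u, htr⟩
end
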